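/- arXiv:1309.0963 — 6 statements merged into one kernel-verified Lean document; each statement's English description precedes it below -/
import Mathlib

section
/- Let τ be a 4×4 symmetric complex matrix. Then A τ ᵗA = τ (equivalently, M·τ = τ for the symplectic action of M on the Siegel space) if and only if there exists a 2×2 complex matrix b such that τ has the block form τ = [[b + ᵗb, −b], [−ᵗb, b + ᵗb]]. -/
open Matrix

/-- The 4×4 matrix `A = [[−I, −I], [I, 0]]` (in 2×2 blocks), over ℂ,
indexed by `Fin 2 ⊕ Fin 2`. It satisfies `A² + A + I = 0`. -/
noncomputable def Amat : Matrix (Fin 2 ⊕ Fin 2) (Fin 2 ⊕ Fin 2) ℂ :=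
  Matrix.fromBlocks (-1) (-1) 1 0

/-- A 4×4 symmetric complex matrix `τ` satisfies `A τ ᵗA = τ` (equivalently `M·τ = τ`
for the symplectic action of `M` on the Siegel space) if and only if there is a
2×2 complex matrix `b` with `τ = [[b + ᵗb, −b], [−ᵗb, b + ᵗb]]`. -/
theorem stmt_0 (τ : Matrix (Fin 2 ⊕ Fin 2) (Fin 2 ⊕ Fin 2) ℂ) (hτ : τ.IsSymm) :
    Amat * τ * Amatᵀ = τ ↔
      ∃ b : Matrix (Fin 2) (Fin 2) ℂ,
        τ = Matrix.fromBlocks (b + bᵀ) (-b) (-bᵀ) (b + bᵀ) := by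
  obtain ⟨p, q, r, s, rfl⟩ : ∃ p q r s, τ = Matrix.fromBlocks p q r s :=
    ⟨_, _, _, _, (Matrix.fromBlocks_toBlocks τ).symm⟩
  obtain ⟨-, rfl, -, -⟩ := Matrix.isSymm_fromBlocks_iff.mp hτ
  simp only [Amat, Matrix.fromBlocks_transpose, Matrix.fromBlocks_multiply,
    Matrix.fromBlocks_inj, Matrix.transpose_neg, Matrix.transpose_one, Matrix.transpose_zero,
    neg_mul, mul_neg, one_mul, mul_one, zero_mul, mul_zero, add_zero]
  constructor
  · rintro ⟨-, h₁₂, -, rfl⟩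
    have hp : p = -q + -qᵀ := calc
      p = -(-p + -qᵀ) + -qᵀ := by abel
      _ = -q + -qᵀ := by rw [h₁₂]
    exact ⟨-q, by simpa using hp, by simp, by simp, by simpa using hp⟩
  · rintro ⟨b, rfl, rfl, -, rfl⟩
    refine ⟨?_, ?_, ?_, rfl⟩ <;> simp only [Matrix.transpose_neg] <;> abel
end

section
/- Let S be a real 8×8 matrix. Then the following are equivalent: (i) S E ᵗS = E and SM = MS (i.e., S lies in the centralizer of M in Sp(8,ℝ)); (ii) S preserves the Hermitian form H_M, i.e., H_M(xS, yS) = H_M(x, y) for all x, y ∈ ℝ⁸. (This identifies the centralizer of M in Sp(8,ℝ) with the unitary group U(H_M) ≅ U(2,2).) -/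
open Matrix

/-- Index type for 8×8 matrices / length-8 row vectors, in 4+4 blocks. -/
abbrev Idx := Fin 4 ⊕ Fin 4

/-- The 4×4 matrix `A = [[−I, −I], [I, 0]]` (in 2×2 blocks), over ℝ. -/
noncomputable def AmatR : Matrix (Fin 4) (Fin 4) ℝ :=
  !![-1, 0, -1, 0; 0, -1, 0, -1; 1, 0, 0, 0; 0, 1, 0, 0]

/-- The matrix `ᵗA⁻¹`, over ℝ. -/
noncomputable def AtinvR : Matrix (Fin 4) (Fin 4) ℝ :=
  !![0, 0, -1, 0; 0, 0, 0, -1; 1, 0, -1, 0; 0, 1, 0, -1]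

/-- The standard symplectic form matrix `E = [[0, I₄], [−I₄, 0]]`, over ℝ. -/
noncomputable def EmatR : Matrix Idx Idx ℝ := Matrix.fromBlocks 0 1 (-1) 0

/-- `M = [[A, 0], [0, ᵗA⁻¹]]`, over ℝ; it satisfies `M E ᵗM = E` and `M² + M + I = 0`. -/
noncomputable def MmatR : Matrix Idx Idx ℝ := Matrix.fromBlocks AmatR 0 0 AtinvR

/-- The alternating form `E(x,y) = x E ᵗy` on complex row vectors. -/
noncomputable def Ebil (x y : Idx → ℂ) : ℂ := x ⬝ᵥ (EmatR.map Complex.ofReal).mulVec y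

/-- The Hermitian form `H_M(x,y) = E(x, yM) − ω E(x,y)`. -/
noncomputable def HM (ω : ℂ) (x y : Idx → ℂ) : ℂ :=
  Ebil x (Matrix.vecMul y (MmatR.map Complex.ofReal)) - ω * Ebil x y

theorem IsPrimitiveRoot.im_ne_zero_of_three {ω : ℂ} (hω : IsPrimitiveRoot ω 3) : ω.im ≠ 0 := by
  intro him
  have hre : (ω.re : ℂ) = ω := Complex.ext rfl (by simp [him])
  have hcube : ω.re ^ 3 = 1 := by
    have := hω.pow_eq_one
    rw [← hre] at this
    exact_mod_cast this
  have hone : ω.re = 1 := by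
    nlinarith [sq_nonneg (ω.re + 1), sq_nonneg ω.re]
  exact hω.ne_one (by norm_num) (by rw [← hre, hone, Complex.ofReal_one])

/-- Real and imaginary coefficients with respect to `1, ω` are unique when `ω` is not real. -/
theorem Complex.ofReal_sub_mul_ofReal_inj {ω : ℂ} (hω : ω.im ≠ 0) {a b c d : ℝ} :
    (a : ℂ) - ω * b = c - ω * d ↔ a = c ∧ b = d := by
  refine ⟨fun h => ?_, by rintro ⟨rfl, rfl⟩; rfl⟩
  have him := congrArg Complex.im h
  have hre := congrArg Complex.re h
  simp only [Complex.sub_im, Complex.sub_re, Complex.mul_im, Complex.mul_re, Complex.ofReal_im,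
    Complex.ofReal_re, mul_zero, zero_sub, zero_add, sub_zero, neg_inj] at him hre
  have hbd : b = d := mul_left_cancel₀ hω him
  subst hbd
  exact ⟨by linarith, rfl⟩

theorem ofReal_vecMul (x : Idx → ℝ) (S : Matrix Idx Idx ℝ) :
    Matrix.vecMul (fun i => (x i : ℂ)) (S.map Complex.ofReal) =
      fun i => ((Matrix.vecMul x S i : ℝ) : ℂ) := by
  ext i
  simp [Matrix.vecMul, dotProduct]

theorem Ebil_ofReal (x y : Idx → ℝ) :
    Ebil (fun i => (x i : ℂ)) (fun i => (y i : ℂ)) = ((x ⬝ᵥ EmatR *ᵥ y : ℝ) : ℂ) := by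
  simp [Ebil, Matrix.mulVec, dotProduct]

theorem HM_ofReal (ω : ℂ) (x y : Idx → ℝ) :
    HM ω (fun i => (x i : ℂ)) (fun i => (y i : ℂ)) =
      ((x ⬝ᵥ (EmatR * MmatRᵀ) *ᵥ y : ℝ) : ℂ) - ω * ((x ⬝ᵥ EmatR *ᵥ y : ℝ) : ℂ) := by
  rw [HM, ofReal_vecMul, Ebil_ofReal, Ebil_ofReal, ← Matrix.mulVec_mulVec, Matrix.mulVec_transpose]

theorem vecMul_dotProduct_mulVec_vecMul (S B : Matrix Idx Idx ℝ) (x y : Idx → ℝ) :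
    (x ᵥ* S) ⬝ᵥ B *ᵥ (y ᵥ* S) = x ⬝ᵥ (S * B * Sᵀ) *ᵥ y := by
  rw [← Matrix.mulVec_transpose S y, ← Matrix.dotProduct_mulVec, Matrix.mulVec_mulVec,
    Matrix.mulVec_mulVec, Matrix.mul_assoc]

theorem forall_dotProduct_mulVec_eq_iff {B C : Matrix Idx Idx ℝ} :
    (∀ x y : Idx → ℝ, x ⬝ᵥ B *ᵥ y = x ⬝ᵥ C *ᵥ y) ↔ B = C := by
  refine ⟨fun h => ?_, by rintro rfl _ _; rfl⟩
  ext i j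
  simpa using h (Pi.single i 1) (Pi.single j 1)

theorem EmatR_mul_self : EmatR * EmatR = -1 := by
  rw [EmatR, Matrix.fromBlocks_multiply, ← Matrix.fromBlocks_one, Matrix.fromBlocks_neg]
  simp

theorem EmatR_mul_transpose_MmatR : EmatR * MmatRᵀ = -((MmatR + 1) * EmatR) := by
  rw [add_mul, one_mul, EmatR, MmatR, Matrix.fromBlocks_transpose, Matrix.fromBlocks_multiply,
    Matrix.fromBlocks_multiply, Matrix.fromBlocks_add, Matrix.fromBlocks_neg]
  congr 1
  · simp
  · ext i j
    fin_cases i <;> fin_cases j <;> simp [AtinvR, AmatR]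
  · ext i j
    fin_cases i <;> fin_cases j <;> simp [AtinvR, AmatR]
  · simp

/-- A symplectic `S` preserves `E ᵗM` exactly when it commutes with `M`. -/
theorem conj_EmatR_mul_transpose_MmatR_iff {S : Matrix Idx Idx ℝ}
    (hS : S * EmatR * Sᵀ = EmatR) :
    S * (EmatR * MmatRᵀ) * Sᵀ = EmatR * MmatRᵀ ↔ S * MmatR = MmatR * S := by
  have hinv : (EmatR * Sᵀ) * (-EmatR * S) = 1 := by
    refine mul_eq_one_comm.mp ?_
    calc -EmatR * S * (EmatR * Sᵀ) = -(EmatR * (S * EmatR * Sᵀ)) := by noncomm_ring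
      _ = 1 := by rw [hS, EmatR_mul_self, neg_neg]
  have hleft : S * (EmatR * MmatRᵀ) * Sᵀ = -(S * MmatR * (EmatR * Sᵀ)) - EmatR := by
    rw [EmatR_mul_transpose_MmatR]
    calc _ = -(S * MmatR * (EmatR * Sᵀ)) - S * EmatR * Sᵀ := by noncomm_ring
      _ = _ := by rw [hS]
  have hright : EmatR * MmatRᵀ = -(MmatR * S * (EmatR * Sᵀ)) - EmatR := by
    rw [EmatR_mul_transpose_MmatR]
    calc _ = -(MmatR * EmatR) - EmatR := by noncomm_ring
      _ = -(MmatR * (S * EmatR * Sᵀ)) - EmatR := by rw [hS]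
      _ = _ := by simp only [Matrix.mul_assoc]
  rw [hleft, hright, sub_left_inj, neg_inj]
  refine ⟨fun h => ?_, fun h => by rw [h]⟩
  have := congrArg (· * (-EmatR * S)) h
  simpa only [Matrix.mul_assoc _ (EmatR * Sᵀ), hinv, Matrix.mul_one] using this

/-- For a real 8×8 matrix `S`, the following are equivalent: (i) `S E ᵗS = E` and
`SM = MS` (i.e. `S` lies in the centralizer of `M` in `Sp(8,ℝ)`); (ii) `S` preserves
the Hermitian form `H_M`, i.e. `H_M(xS, yS) = H_M(x,y)` for all real row vectors `x, y`.
(This identifies the centralizer of `M` in `Sp(8,ℝ)` with `U(H_M) ≅ U(2,2)`.) -/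
theorem stmt_4 (ω : ℂ) (hω : IsPrimitiveRoot ω 3) (S : Matrix Idx Idx ℝ) :
    (S * EmatR * Sᵀ = EmatR ∧ S * MmatR = MmatR * S) ↔
      (∀ x y : Idx → ℝ,
        HM ω (Matrix.vecMul (fun i => (x i : ℂ)) (S.map Complex.ofReal))
             (Matrix.vecMul (fun i => (y i : ℂ)) (S.map Complex.ofReal)) =
        HM ω (fun i => (x i : ℂ)) (fun i => (y i : ℂ))) := by
  simp only [ofReal_vecMul, HM_ofReal, Complex.ofReal_sub_mul_ofReal_inj hω.im_ne_zero_of_three,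
    vecMul_dotProduct_mulVec_vecMul, forall_and, forall_dotProduct_mulVec_eq_iff]
  rw [and_comm (a := S * (EmatR * MmatRᵀ) * Sᵀ = EmatR * MmatRᵀ)]
  exact and_congr_right fun hS => (conj_EmatR_mul_transpose_MmatR_iff hS).symm
end

section
/- The subgroup of GL(6,ℚ) generated by the four matrices g_B, g_d, g_e, g_f is a finite group of order 51840 (it is isomorphic to the Weyl group W(E₆) of the root system E₆). -/
open Matrix

/-- The canonical ring homomorphism from integer 6×6 matrices to rational 6×6 matrices. -/
def φ : Matrix (Fin 6) (Fin 6) ℤ →+* Matrix (Fin 6) (Fin 6) ℚ :=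
  (Int.castRingHom ℚ).mapMatrix

/-- `g_B` swaps the last two coordinates `X₆, X₇` and fixes the other coordinates. -/
def gB : Matrix (Fin 6) (Fin 6) ℚ :=
  φ !![1,0,0,0,0,0; 0,1,0,0,0,0; 0,0,1,0,0,0; 0,0,0,1,0,0; 0,0,0,0,0,1; 0,0,0,0,1,0]

/-- `g_d = diag(1, 1, −1, −1, −1, −1)`. -/
def gd : Matrix (Fin 6) (Fin 6) ℚ :=
  φ !![1,0,0,0,0,0; 0,1,0,0,0,0; 0,0,-1,0,0,0; 0,0,0,-1,0,0; 0,0,0,0,-1,0; 0,0,0,0,0,-1]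

/-- `g_e = diag(1, 1, 1, −1, −1, 1)`. -/
def ge : Matrix (Fin 6) (Fin 6) ℚ :=
  φ !![1,0,0,0,0,0; 0,1,0,0,0,0; 0,0,1,0,0,0; 0,0,0,-1,0,0; 0,0,0,0,-1,0; 0,0,0,0,0,1]

/-- `g_f`, acting on column vectors. -/
def gf : Matrix (Fin 6) (Fin 6) ℚ :=
  (1/4 : ℚ) • φ !![1,3,3,3,3,3; 1,-1,3,-1,-1,-1; 1,3,-1,-1,-1,-1;
                   1,-1,-1,3,-1,-1; 1,-1,-1,-1,-1,3; 1,-1,-1,-1,3,-1]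

lemma gB_sq : gB * gB = 1 := by
  rw [gB, ← _root_.map_mul, show (!![1,0,0,0,0,0; 0,1,0,0,0,0; 0,0,1,0,0,0; 0,0,0,1,0,0;
    0,0,0,0,0,1; 0,0,0,0,1,0] : Matrix (Fin 6) (Fin 6) ℤ) * _ = 1 by decide, _root_.map_one]

lemma gd_sq : gd * gd = 1 := by
  rw [gd, ← _root_.map_mul, show (!![1,0,0,0,0,0; 0,1,0,0,0,0; 0,0,-1,0,0,0; 0,0,0,-1,0,0;
    0,0,0,0,-1,0; 0,0,0,0,0,-1] : Matrix (Fin 6) (Fin 6) ℤ) * _ = 1 by decide, _root_.map_one]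

lemma ge_sq : ge * ge = 1 := by
  rw [ge, ← _root_.map_mul, show (!![1,0,0,0,0,0; 0,1,0,0,0,0; 0,0,1,0,0,0; 0,0,0,-1,0,0;
    0,0,0,0,-1,0; 0,0,0,0,0,1] : Matrix (Fin 6) (Fin 6) ℤ) * _ = 1 by decide, _root_.map_one]

lemma gf_sq : gf * gf = 1 := by
  rw [gf, smul_mul_smul_comm, ← _root_.map_mul,
    show (!![1,3,3,3,3,3; 1,-1,3,-1,-1,-1; 1,3,-1,-1,-1,-1; 1,-1,-1,3,-1,-1;
      1,-1,-1,-1,-1,3; 1,-1,-1,-1,3,-1] : Matrix (Fin 6) (Fin 6) ℤ) * _ = 16 by decide,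
    map_ofNat φ 16,
    ← map_ofNat (algebraMap ℚ (Matrix (Fin 6) (Fin 6) ℚ)) 16,
    Algebra.algebraMap_eq_smul_one, smul_smul]
  norm_num

/-- `g_B` as an element of `GL(6,ℚ)` (it is an involution). -/
def gBu : GL (Fin 6) ℚ := ⟨gB, gB, gB_sq, gB_sq⟩

/-- `g_d` as an element of `GL(6,ℚ)` (it is an involution). -/
def gdu : GL (Fin 6) ℚ := ⟨gd, gd, gd_sq, gd_sq⟩

/-- `g_e` as an element of `GL(6,ℚ)` (it is an involution). -/
def geu : GL (Fin 6) ℚ := ⟨ge, ge, ge_sq, ge_sq⟩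

/-- `g_f` as an element of `GL(6,ℚ)` (it is an involution). -/
def gfu : GL (Fin 6) ℚ := ⟨gf, gf, gf_sq, gf_sq⟩

/-! ### Stabilizer chains of permutation groups -/

section StabilizerChain

variable {α : Type*}

/-- The elements of `H` fixing every point of the list `l`. -/
def fixingList (H : Subgroup (Equiv.Perm α)) (l : List α) : Subgroup (Equiv.Perm α) where
  carrier := {σ | σ ∈ H ∧ ∀ b ∈ l, σ b = b}
  one_mem' := ⟨H.one_mem, fun _ _ => rfl⟩
  mul_mem' {σ τ} hσ hτ := ⟨H.mul_mem hσ.1 hτ.1, fun b hb => by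
    rw [Equiv.Perm.mul_apply, hτ.2 b hb, hσ.2 b hb]⟩
  inv_mem' {σ} hσ := ⟨H.inv_mem hσ.1, fun b hb => by
    rw [Equiv.Perm.inv_eq_iff_eq, hσ.2 b hb]⟩

lemma mem_fixingList {H : Subgroup (Equiv.Perm α)} {l : List α} {σ : Equiv.Perm α} :
    σ ∈ fixingList H l ↔ σ ∈ H ∧ ∀ b ∈ l, σ b = b := Iff.rfl

lemma fixingList_nil (H : Subgroup (Equiv.Perm α)) : fixingList H [] = H := by
  ext σ; simp [mem_fixingList]

lemma fixingList_cons (H : Subgroup (Equiv.Perm α)) (x : α) (l : List α) :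
    fixingList H (x :: l) = fixingList H l ⊓ MulAction.stabilizer (Equiv.Perm α) x := by
  ext σ
  simp only [mem_fixingList, Subgroup.mem_inf, MulAction.mem_stabilizer_iff, List.forall_mem_cons,
    Equiv.Perm.smul_def]
  tauto

/-- The orbit-stabilizer theorem for a subgroup of a permutation group, with the stabilizer taken
in the ambient group. -/
lemma card_eq_ncard_orbit_mul (H : Subgroup (Equiv.Perm α)) (x : α) :
    Nat.card H = (MulAction.orbit H x).ncard *
      Nat.card (H ⊓ MulAction.stabilizer (Equiv.Perm α) x : Subgroup (Equiv.Perm α)) := by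
  have h : (H ⊓ MulAction.stabilizer (Equiv.Perm α) x) =
      (MulAction.stabilizer H x).map H.subtype := by
    ext σ
    simp [MulAction.mem_stabilizer_iff, Subgroup.smul_def, and_comm]
  rw [h, Subgroup.card_map_of_injective H.subtype_injective, ← MulAction.index_stabilizer, mul_comm,
    Subgroup.card_mul_index]

variable [DecidableEq α]

/-- The points reached from `x` by applying at most `n` of the permutations in `T`. -/
def reach (T : List (Equiv.Perm α)) (x : α) : ℕ → List α
  | 0 => [x]
  | n + 1 => (reach T x n ++ T.flatMap fun σ => (reach T x n).map (σ ·)).dedup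

lemma mem_orbit_of_mem_reach {H : Subgroup (Equiv.Perm α)} {T : List (Equiv.Perm α)}
    (hT : ∀ σ ∈ T, σ ∈ H) {x p : α} {n : ℕ} (hp : p ∈ reach T x n) : p ∈ MulAction.orbit H x := by
  induction n generalizing p with
  | zero =>
    rw [reach, List.mem_singleton] at hp
    rw [hp]
    exact MulAction.mem_orbit_self x
  | succ n ih =>
    simp only [reach, List.mem_dedup, List.mem_append, List.mem_flatMap, List.mem_map] at hp
    obtain hp | ⟨σ, hσ, q, hq, rfl⟩ := hp
    · exact ih hp
    · exact MulAction.mem_orbit_of_mem_orbit (⟨σ, hT σ hσ⟩ : H) (ih hq)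

/-- One step of a stabilizer chain: if `H` preserves the relation-valued function `A`, and every
point in the same `A`-position as `x` relative to `l` is reached from `x` by the elements of `T`
fixing `l`, then the index of the next stabilizer is the number `N` of those points. -/
lemma card_fixingList_eq_mul [Fintype α] {β : Type*} [DecidableEq β] {H : Subgroup (Equiv.Perm α)}
    {A : α → α → β} (hA : ∀ σ ∈ H, ∀ p q, A (σ p) (σ q) = A p q)
    {T : List (Equiv.Perm α)} (hT : ∀ σ ∈ T, σ ∈ H) (l : List α) (x : α) (n N : ℕ)
    (hN : (Finset.univ.filter fun p => ∀ b ∈ l, A p b = A x b).card = N)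
    (h : ∀ p, (∀ b ∈ l, A p b = A x b) → p ∈ reach (T.filter fun σ => ∀ b ∈ l, σ b = b) x n) :
    Nat.card (fixingList H l) = N * Nat.card (fixingList H (x :: l)) := by
  rw [card_eq_ncard_orbit_mul _ x, fixingList_cons, ← hN, ← Set.ncard_coe_finset]
  congr 2
  ext p
  simp only [Finset.coe_filter, Finset.mem_univ, true_and, Set.mem_ofPred_eq]
  constructor
  · rintro ⟨⟨σ, hσ⟩, rfl⟩ b hb
    have := hA σ hσ.1 x b
    rwa [hσ.2 b hb] at this
  · intro hp
    refine mem_orbit_of_mem_reach (fun σ hσ => ?_) (h p hp)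
    simp only [List.mem_filter, decide_eq_true_eq] at hσ
    exact ⟨hT σ hσ.1, hσ.2⟩

end StabilizerChain

/-! ### The orbit of 27 vectors -/

/-- The orbit of `(4, 0, 0, 0, 0, 0)` under the four matrices. -/
def orbitVec : Fin 27 → Fin 6 → ℤ :=
  ![![4, 0, 0, 0, 0, 0], ![1, 1, 1, 1, 1, 1], ![1, 1, 1, 1, -1, -1], ![1, 1, 1, -1, 1, -1],
    ![1, 1, 1, -1, -1, 1], ![1, 1, -1, 1, 1, -1], ![1, 1, -1, 1, -1, 1],
    ![1, 1, -1, -1, 1, 1], ![1, 1, -1, -1, -1, -1], ![1, -1, 1, 1, 1, -1],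
    ![1, -1, 1, 1, -1, 1], ![1, -1, 1, -1, 1, 1], ![1, -1, 1, -1, -1, -1],
    ![1, -1, -1, 1, 1, 1], ![1, -1, -1, 1, -1, -1], ![1, -1, -1, -1, 1, -1],
    ![1, -1, -1, -1, -1, 1], ![-2, 2, 0, 0, 0, 0], ![-2, 0, 2, 0, 0, 0], ![-2, 0, 0, 2, 0, 0],
    ![-2, 0, 0, 0, 2, 0], ![-2, 0, 0, 0, 0, 2], ![-2, 0, 0, 0, 0, -2], ![-2, 0, 0, 0, -2, 0],
    ![-2, 0, 0, -2, 0, 0], ![-2, 0, -2, 0, 0, 0], ![-2, -2, 0, 0, 0, 0]]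

/-- The inner product on the orbit for the invariant quadratic form
`X₀² + 3 (X₁² + X₂² + X₃² + X₆² + X₇²)`. -/
def orbitForm (p q : Fin 27) : ℤ :=
  orbitVec p 0 * orbitVec q 0 + 3 * (orbitVec p 1 * orbitVec q 1 + orbitVec p 2 * orbitVec q 2 +
    orbitVec p 3 * orbitVec q 3 + orbitVec p 4 * orbitVec q 4 + orbitVec p 5 * orbitVec q 5)

/-- The permutation of the orbit induced by `g_B`. -/
def permB : Equiv.Perm (Fin 27) :=
  Function.Involutive.toPerm
    ![0, 1, 2, 4, 3, 6, 5, 7, 8, 10, 9, 11, 12, 13, 14, 16, 15, 17, 18, 19, 21, 20, 23, 22,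
      24, 25, 26] (by unfold Function.Involutive; decide)

/-- The permutation of the orbit induced by `g_d`. -/
def permD : Equiv.Perm (Fin 27) :=
  Function.Involutive.toPerm
    ![0, 8, 7, 6, 5, 4, 3, 2, 1, 16, 15, 14, 13, 12, 11, 10, 9, 17, 25, 24, 23, 22, 21, 20,
      19, 18, 26] (by unfold Function.Involutive; decide)

/-- The permutation of the orbit induced by `g_e`. -/
def permE : Equiv.Perm (Fin 27) :=
  Function.Involutive.toPerm
    ![0, 4, 3, 2, 1, 8, 7, 6, 5, 12, 11, 10, 9, 16, 15, 14, 13, 17, 18, 24, 23, 21, 22, 20,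
      19, 25, 26] (by unfold Function.Involutive; decide)

/-- The permutation of the orbit induced by `g_f`. -/
def permF : Equiv.Perm (Fin 27) :=
  Function.Involutive.toPerm
    ![1, 0, 2, 4, 3, 10, 9, 11, 18, 6, 5, 7, 17, 13, 19, 21, 20, 12, 8, 14, 16, 15, 23, 22,
      24, 26, 25] (by unfold Function.Involutive; decide)

/-- The permutation group of the orbit generated by the four matrices. -/
def permGroup : Subgroup (Equiv.Perm (Fin 27)) :=
  Subgroup.closure {permB, permD, permE, permF}

/-- Enough elements of `permGroup` for their subsets fixing the first few of the points
`0, 18, 17, 21, 19` to act transitively at each step of the stabilizer chain. -/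
def strongGenerators : List (Equiv.Perm (Fin 27)) :=
  [permB, permD, permE, permF,
    permF * permE * permF * permE * permB * permE * permF * permE * permF,
    permF * permD * permF * permE * permF * permD * permF,
    permF * permE * permB * permF * permE * permF]

lemma mem_permGroup_of_mem_strongGenerators (σ : Equiv.Perm (Fin 27)) (hσ : σ ∈ strongGenerators) :
    σ ∈ permGroup := by
  have hB : permB ∈ permGroup := Subgroup.subset_closure (by simp)
  have hD : permD ∈ permGroup := Subgroup.subset_closure (by simp)
  have hE : permE ∈ permGroup := Subgroup.subset_closure (by simp)
  have hF : permF ∈ permGroup := Subgroup.subset_closure (by simp)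
  simp only [strongGenerators, List.mem_cons, List.not_mem_nil, or_false] at hσ
  rcases hσ with rfl | rfl | rfl | rfl | rfl | rfl | rfl <;>
    repeat' first | assumption | apply mul_mem

lemma orbitForm_permGroup (σ : Equiv.Perm (Fin 27)) (hσ : σ ∈ permGroup) (p q : Fin 27) :
    orbitForm (σ p) (σ q) = orbitForm p q := by
  induction hσ using Subgroup.closure_induction generalizing p q with
  | mem σ hσ =>
    simp only [Set.mem_insert_iff, Set.mem_singleton_iff] at hσ
    revert p q
    rcases hσ with rfl | rfl | rfl | rfl <;> decide +kernel
  | one => rfl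
  | mul σ τ _ _ hσ hτ => rw [Equiv.Perm.mul_apply, Equiv.Perm.mul_apply, hσ, hτ]
  | inv σ _ hσ => simpa using (hσ (σ⁻¹ p) (σ⁻¹ q)).symm

lemma fixingList_permGroup_eq_bot : fixingList permGroup [19, 21, 17, 18, 0] = ⊥ := by
  rw [eq_bot_iff]
  rintro σ ⟨hσ, hfix⟩
  have key (l : List (Fin 27)) (hl : ∀ b ∈ l, σ b = b) (p : Fin 27)
      (hp : ∀ q, (∀ b ∈ l, orbitForm q b = orbitForm p b) → q = p) : σ p = p :=
    hp _ fun b hb => by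
      conv_lhs => rw [← hl b hb]
      exact orbitForm_permGroup σ hσ p b
  have h1 : σ 1 = 1 := key _ hfix 1 (by decide +kernel)
  have hfix' : ∀ b ∈ [1, 19, 21, 17, 18, 0], σ b = b := List.forall_mem_cons.2 ⟨h1, hfix⟩
  rw [Subgroup.mem_bot]
  ext1 p
  refine key _ hfix' p ?_
  revert p
  decide +kernel

lemma card_permGroup : Nat.card permGroup = 51840 := by
  have step := card_fixingList_eq_mul orbitForm_permGroup mem_permGroup_of_mem_strongGenerators
  rw [← fixingList_nil permGroup,
    step [] 0 8 27 (by decide +kernel) (by decide +kernel),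
    step [0] 18 8 10 (by decide +kernel) (by decide +kernel),
    step [18, 0] 17 8 8 (by decide +kernel) (by decide +kernel),
    step [17, 18, 0] 21 8 6 (by decide +kernel) (by decide +kernel),
    step [21, 17, 18, 0] 19 8 4 (by decide +kernel) (by decide +kernel),
    fixingList_permGroup_eq_bot, Subgroup.card_bot]

/-! ### Comparison of the matrix group and the permutation group -/

/-- The vectors of the orbit, with rational coordinates. -/
def orbitVecRat (p : Fin 27) : Fin 6 → ℚ := fun i => orbitVec p i

lemma orbitVecRat_injective : Function.Injective orbitVecRat := by
  have h : Function.Injective orbitVec := by decide +kernel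
  intro p q hpq
  refine h (funext fun i => ?_)
  exact Int.cast_injective (congrFun hpq i)

/-- The orbit spans `ℚ⁶`. -/
lemma eq_of_mulVec_orbitVecRat {M N : Matrix (Fin 6) (Fin 6) ℚ}
    (h : ∀ p, M *ᵥ orbitVecRat p = N *ᵥ orbitVecRat p) : M = N := by
  ext i j
  have h0 := congrFun (h 0) i
  have h1 := congrFun (h 17) i
  have h2 := congrFun (h 18) i
  have h3 := congrFun (h 19) i
  have h4 := congrFun (h 20) i
  have h5 := congrFun (h 21) i
  simp [Matrix.mulVec, dotProduct, Fin.sum_univ_six, orbitVecRat, orbitVec]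
    at h0 h1 h2 h3 h4 h5
  fin_cases j <;> simp <;> linarith

lemma φ_mulVec_orbitVecRat (M : Matrix (Fin 6) (Fin 6) ℤ) (p : Fin 27) :
    φ M *ᵥ orbitVecRat p = fun i => ((M *ᵥ orbitVec p) i : ℚ) := by
  ext i
  simp [φ, Matrix.mulVec, dotProduct, orbitVecRat]

/-- The pairs of a matrix and a permutation inducing the same action on the orbit. -/
def compatiblePairs : Subgroup (GL (Fin 6) ℚ × Equiv.Perm (Fin 27)) where
  carrier := {x | ∀ p, (x.1 : Matrix (Fin 6) (Fin 6) ℚ) *ᵥ orbitVecRat p = orbitVecRat (x.2 p)}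
  one_mem' p := by simp
  mul_mem' {x y} hx hy p := by
    simp only [Prod.fst_mul, Prod.snd_mul, Units.val_mul, Equiv.Perm.mul_apply]
    rw [← Matrix.mulVec_mulVec, hy p, hx]
  inv_mem' {x} hx p := by
    have := hx (x.2⁻¹ p)
    rw [← Equiv.Perm.mul_apply, mul_inv_cancel, Equiv.Perm.one_apply] at this
    simp only [Prod.fst_inv, Prod.snd_inv]
    rw [← this, Matrix.mulVec_mulVec, ← Units.val_mul, inv_mul_cancel, Units.val_one,
      Matrix.one_mulVec]

lemma injOn_fst_compatiblePairs :
    Set.InjOn (MonoidHom.fst (GL (Fin 6) ℚ) (Equiv.Perm (Fin 27))) compatiblePairs := by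
  rintro ⟨g, σ⟩ hσ ⟨g', τ⟩ hτ (rfl : g = g')
  refine Prod.ext rfl (Equiv.ext fun p => orbitVecRat_injective ?_)
  exact (hσ p).symm.trans (hτ p)

lemma injOn_snd_compatiblePairs :
    Set.InjOn (MonoidHom.snd (GL (Fin 6) ℚ) (Equiv.Perm (Fin 27))) compatiblePairs := by
  rintro ⟨g, σ⟩ hg ⟨g', τ⟩ hg' (rfl : σ = τ)
  refine Prod.ext (Units.ext (eq_of_mulVec_orbitVecRat fun p => ?_)) rfl
  exact (hg p).trans (hg' p).symm

/-- The four generating pairs. -/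
def generatorPairs : Set (GL (Fin 6) ℚ × Equiv.Perm (Fin 27)) :=
  {(gBu, permB), (gdu, permD), (geu, permE), (gfu, permF)}

lemma closure_generatorPairs_le : Subgroup.closure generatorPairs ≤ compatiblePairs := by
  rw [Subgroup.closure_le]
  rintro x (rfl | rfl | rfl | rfl) p
  · refine (φ_mulVec_orbitVecRat _ p).trans (funext fun i => congrArg Int.cast ?_)
    revert p i
    decide +kernel
  · refine (φ_mulVec_orbitVecRat _ p).trans (funext fun i => congrArg Int.cast ?_)
    revert p i
    decide +kernel
  · refine (φ_mulVec_orbitVecRat _ p).trans (funext fun i => congrArg Int.cast ?_)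
    revert p i
    decide +kernel
  · change gf *ᵥ _ = _
    rw [gf, Matrix.smul_mulVec, φ_mulVec_orbitVecRat]
    ext i
    rw [Pi.smul_apply, smul_eq_mul, one_div, inv_mul_eq_iff_eq_mul₀ (by norm_num)]
    change _ = 4 * ((orbitVec (permF p) i : ℤ) : ℚ)
    norm_cast
    revert p i
    decide +kernel

/-- The subgroup of `GL(6,ℚ)` generated by `g_B, g_d, g_e, g_f` is a finite group of
order 51840 (it is isomorphic to the Weyl group `W(E₆)` of the root system `E₆`). -/
theorem stmt_5 :
    Nat.card (Subgroup.closure ({gBu, gdu, geu, gfu} : Set (GL (Fin 6) ℚ))) = 51840 := by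
  have h₁ : Subgroup.closure ({gBu, gdu, geu, gfu} : Set (GL (Fin 6) ℚ)) =
      (Subgroup.closure generatorPairs).map (MonoidHom.fst _ _) := by
    simp [MonoidHom.map_closure, generatorPairs, Set.image_insert_eq]
  have h₂ : permGroup = (Subgroup.closure generatorPairs).map (MonoidHom.snd _ _) := by
    simp [MonoidHom.map_closure, generatorPairs, Set.image_insert_eq, permGroup]
  calc Nat.card (Subgroup.closure ({gBu, gdu, geu, gfu} : Set (GL (Fin 6) ℚ)))
      = Nat.card (Subgroup.closure generatorPairs) := by
        rw [h₁]
        exact Nat.card_image_of_injOn (injOn_fst_compatiblePairs.mono closure_generatorPairs_le)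
    _ = Nat.card permGroup := by
        rw [h₂]
        exact (Nat.card_image_of_injOn
          (injOn_snd_compatiblePairs.mono closure_generatorPairs_le)).symm
    _ = 51840 := card_permGroup
end

section
/- Both M_pr and M_ip belong to Sp(8,ℤ), but they are not conjugate in Sp(8,ℤ): there is no S ∈ Sp(8,ℤ) with S M_pr S⁻¹ = M_ip. (Indeed the alternating form E restricts with determinant 1 to the sublattice ker(M_pr − I) ≅ ℤ⁴ but with determinant 9 to ker(M_ip − I) ≅ ℤ⁴.) -/
open Matrix

/-- The standard symplectic form matrix `E = [[0, I₄], [−I₄, 0]]`. -/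
def Emat : Matrix Idx Idx ℤ := Matrix.fromBlocks 0 1 (-1) 0

/-- `S ∈ Sp(8,ℤ)` iff `S E ᵗS = E`. -/
def InSp (S : Matrix Idx Idx ℤ) : Prop := S * Emat * Sᵀ = Emat

/-- The 4×4 integer matrix `A_p`. -/
def Ap : Matrix (Fin 4) (Fin 4) ℤ :=
  !![-1, 0, -1, 0; 0, 1, 0, 0; 1, 0, 0, 0; 0, 0, 0, 1]

/-- The matrix `ᵗA_p⁻¹`. -/
def Aptinv : Matrix (Fin 4) (Fin 4) ℤ :=
  !![0, 0, -1, 0; 0, 1, 0, 0; 1, 0, -1, 0; 0, 0, 0, 1]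

/-- The 4×4 integer matrix `B_ip`. -/
def Bip : Matrix (Fin 4) (Fin 4) ℤ :=
  !![0, -2, 0, 0; 2, 0, 0, 0; 0, 2, 0, -2; -2, 0, 2, 0]

/-- `M_pr = [[A_p, 0], [0, ᵗA_p⁻¹]]`. -/
def Mpr : Matrix Idx Idx ℤ := Matrix.fromBlocks Ap 0 0 Aptinv

/-- `M_ip = [[A_p, B_ip], [0, ᵗA_p⁻¹]]`. -/
def Mip : Matrix Idx Idx ℤ := Matrix.fromBlocks Ap Bip 0 Aptinv

/-- The alternating form `x E ᵗy` on row vectors. -/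
def sympForm (x y : Idx → ℤ) : ℤ := (x ᵥ* Emat) ⬝ᵥ y

theorem sympForm_eq (x y : Idx → ℤ) :
    sympForm x y = ∑ i, (x (.inl i) * y (.inr i) - x (.inr i) * y (.inl i)) := by
  simp [sympForm, Emat, vecMul, dotProduct, Fin.sum_univ_four, fromBlocks, one_apply]
  ring

theorem InSp.sympForm_vecMul {S : Matrix Idx Idx ℤ} (hS : InSp S) (x y : Idx → ℤ) :
    sympForm (x ᵥ* S) (y ᵥ* S) = sympForm x y := by
  unfold InSp at hS
  have h : sympForm (x ᵥ* S) (y ᵥ* S) = (x ᵥ* (S * Emat * Sᵀ)) ⬝ᵥ y := by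
    rw [sympForm, ← mulVec_transpose S y, dotProduct_mulVec]
    simp [vecMul_vecMul, Matrix.mul_assoc]
  rw [h, hS, sympForm]

/-- A vector in the radical modulo 3 of the form on the sublattice fixed by `M_ip`. -/
def radVec : Idx → ℤ := Sum.elim 0 ![0, 1, 0, -2]

theorem radVec_vecMul_Mip : radVec ᵥ* Mip = radVec := by decide

theorem three_dvd_sympForm_radVec {y : Idx → ℤ} (hy : y ᵥ* Mip = y) :
    3 ∣ sympForm radVec y := by
  have h1 := congrFun hy (.inr 0)
  have h3 := congrFun hy (.inr 2)
  have h4 := congrFun hy (.inl 0)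
  have h5 := congrFun hy (.inl 2)
  simp [Mip, Ap, Bip, Aptinv, vecMul, dotProduct, Fin.sum_univ_four] at h1 h3 h4 h5
  simp [sympForm_eq, radVec, Fin.sum_univ_four]
  omega

theorem three_dvd_of_vecMul_Mpr {x : Idx → ℤ} (hx : x ᵥ* Mpr = x)
    (h : ∀ z : Idx → ℤ, z ᵥ* Mpr = z → 3 ∣ sympForm x z) (k : Idx) : 3 ∣ x k := by
  have h1 := congrFun hx (.inr 0)
  have h3 := congrFun hx (.inr 2)
  have h4 := congrFun hx (.inl 0)
  have h5 := congrFun hx (.inl 2)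
  simp [Mpr, Ap, Aptinv, vecMul, dotProduct, Fin.sum_univ_four] at h1 h3 h4 h5
  have k1 := h (Pi.single (.inl 1) 1) (by decide)
  have k2 := h (Pi.single (.inl 3) 1) (by decide)
  have k3 := h (Pi.single (.inr 1) 1) (by decide)
  have k4 := h (Pi.single (.inr 3) 1) (by decide)
  simp [sympForm_eq, Pi.single_apply] at k1 k2 k3 k4
  rcases k with k | k <;> fin_cases k <;> simp <;> omega

/-- `M_pr` and `M_ip` both belong to `Sp(8,ℤ)`, but they are not conjugate in `Sp(8,ℤ)`:
there is no `S ∈ Sp(8,ℤ)` with `S M_pr S⁻¹ = M_ip`. -/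
theorem stmt_11 :
    InSp Mpr ∧ InSp Mip ∧
    ¬ ∃ S Sinv : Matrix Idx Idx ℤ,
        InSp S ∧ S * Sinv = 1 ∧ Sinv * S = 1 ∧ S * Mpr * Sinv = Mip := by
  refine ⟨by unfold InSp; decide, by unfold InSp; decide, ?_⟩
  rintro ⟨S, T, hS, hST, hTS, hconj⟩
  have hSM : S * Mpr = Mip * S := by
    rw [← hconj, Matrix.mul_assoc, hTS, Matrix.mul_one]
  have hMT : Mpr * T = T * Mip := by
    rw [← hconj, Matrix.mul_assoc S, ← Matrix.mul_assoc T, hTS, Matrix.one_mul]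
  have hfix : (radVec ᵥ* S) ᵥ* Mpr = radVec ᵥ* S := by
    rw [vecMul_vecMul, hSM, ← vecMul_vecMul, radVec_vecMul_Mip]
  have hdvd := three_dvd_of_vecMul_Mpr hfix fun z hz => by
    have hzT : (z ᵥ* T) ᵥ* Mip = z ᵥ* T := by
      rw [vecMul_vecMul, ← hMT, ← vecMul_vecMul, hz]
    have hz' : z = (z ᵥ* T) ᵥ* S := by rw [vecMul_vecMul, hTS, vecMul_one]
    rw [hz', hS.sympForm_vecMul]
    exact three_dvd_sympForm_radVec hzT
  have hrad : radVec = (radVec ᵥ* S) ᵥ* T := by rw [vecMul_vecMul, hST, vecMul_one]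
  have h3 : (3 : ℤ) ∣ radVec (.inr 1) := by
    rw [hrad, vecMul, dotProduct]
    exact Finset.dvd_sum fun i _ => (hdvd i).mul_right _
  revert h3
  decide
end

section
/- Let τ be a 4×4 symmetric complex matrix and let B := [[0, I], [I, 0]] (4×4, with 2×2 identity blocks I). Then τ satisfies both A τ ᵗA = τ and B τ B = τ if and only if there exists a 2×2 symmetric complex matrix τ₂ such that τ = [[2τ₂, −τ₂], [−τ₂, 2τ₂]]. Moreover, for such τ, if the imaginary part of τ₂ is positive definite then the imaginary part of τ is positive definite; hence τ₂ ↦ [[2τ₂, −τ₂], [−τ₂, 2τ₂]] identifies the Siegel upper half space ℋ₂ with the fixed locus ℋ₄^{M,M_B}. -/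
open Matrix

/-- The 4×4 matrix `B = [[0, I], [I, 0]]` (in 2×2 blocks), over ℂ. -/
noncomputable def Bmat : Matrix (Fin 2 ⊕ Fin 2) (Fin 2 ⊕ Fin 2) ℂ :=
  Matrix.fromBlocks 0 1 1 0

namespace Matrix

/-- The block matrix `[[2S, -S], [-S, 2S]]`, the Kronecker product of a positive definite `2 × 2`
matrix with `S`, is positive definite if the real matrix `S` is. -/
theorem PosDef.fromBlocks_two_smul_neg {n : Type*} [Fintype n] {S : Matrix n n ℝ}
    (hS : S.PosDef) :
    (fromBlocks ((2 : ℝ) • S) (-S) (-S) ((2 : ℝ) • S)).PosDef := by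
  have hH : Sᴴ = S := hS.isHermitian
  refine .of_dotProduct_mulVec_pos ?_ fun x hx => ?_
  · rw [IsHermitian, fromBlocks_conjTranspose, conjTranspose_smul, conjTranspose_neg, hH,
      star_trivial]
  · obtain ⟨u, v, rfl⟩ : ∃ u v, x = Sum.elim u v := ⟨_, _, (Sum.elim_comp_inl_inr x).symm⟩
    have hnonneg (w : n → ℝ) : 0 ≤ w ⬝ᵥ S *ᵥ w := by
      simpa using hS.posSemidef.dotProduct_mulVec_nonneg w
    have hpos (w : n → ℝ) (hw : w ≠ 0) : 0 < w ⬝ᵥ S *ᵥ w := by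
      simpa using hS.dotProduct_mulVec_pos hw
    have hkey : star (Sum.elim u v) ⬝ᵥ
        fromBlocks ((2 : ℝ) • S) (-S) (-S) ((2 : ℝ) • S) *ᵥ Sum.elim u v =
        u ⬝ᵥ S *ᵥ u + v ⬝ᵥ S *ᵥ v + (u - v) ⬝ᵥ S *ᵥ (u - v) := by
      simp only [star_trivial, fromBlocks_mulVec, Sum.elim_comp_inl, Sum.elim_comp_inr,
        sumElim_dotProduct_sumElim, smul_mulVec, neg_mulVec, mulVec_sub, dotProduct_add,
        dotProduct_smul, dotProduct_neg, dotProduct_sub, sub_dotProduct, smul_eq_mul]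
      ring
    rw [hkey]
    have hu := hnonneg u
    have hv := hnonneg v
    have huv := hnonneg (u - v)
    by_cases hu0 : u = 0
    · have hv0 : v ≠ 0 := by
        rintro rfl
        exact hx (by simp [hu0])
      linarith [hpos v hv0]
    · linarith [hpos u hu0]

end Matrix

/-- A 4×4 symmetric complex matrix `τ` satisfies `A τ ᵗA = τ` and `B τ B = τ`
(i.e. `M·τ = τ` and `M_B·τ = τ`) iff `τ = [[2τ₂, −τ₂], [−τ₂, 2τ₂]]` for a symmetric
2×2 matrix `τ₂`; moreover if `Im τ₂` is positive definite then so is `Im τ`.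
Hence `τ₂ ↦ [[2τ₂, −τ₂], [−τ₂, 2τ₂]]` identifies `ℋ₂` with `ℋ₄^{M,M_B}`. -/
theorem stmt_15 (τ : Matrix (Fin 2 ⊕ Fin 2) (Fin 2 ⊕ Fin 2) ℂ) (hτ : τ.IsSymm) :
    ((Amat * τ * Amatᵀ = τ ∧ Bmat * τ * Bmat = τ) ↔
      ∃ τ2 : Matrix (Fin 2) (Fin 2) ℂ, τ2.IsSymm ∧
        τ = Matrix.fromBlocks ((2 : ℂ) • τ2) (-τ2) (-τ2) ((2 : ℂ) • τ2)) ∧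
    (∀ τ2 : Matrix (Fin 2) (Fin 2) ℂ,
      τ = Matrix.fromBlocks ((2 : ℂ) • τ2) (-τ2) (-τ2) ((2 : ℂ) • τ2) →
      (τ2.map Complex.im).PosDef → (τ.map Complex.im).PosDef) := by
  refine ⟨⟨fun ⟨hA, hB⟩ => ?_, ?_⟩, ?_⟩
  · obtain ⟨a, b, c, d, rfl⟩ : ∃ a b c d, τ = fromBlocks a b c d :=
      ⟨_, _, _, _, (fromBlocks_toBlocks τ).symm⟩
    simp only [Amat, Bmat, fromBlocks_transpose, fromBlocks_multiply, fromBlocks_inj] at hA hB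
    obtain ⟨-, hb, -, had⟩ := hA
    obtain ⟨-, hc, -, -⟩ := hB
    simp at hb had hc
    obtain ⟨-, hbt, -, -⟩ := isSymm_fromBlocks_iff.mp hτ
    subst had hc
    have ha : a = (2 : ℂ) • -c := by
      rw [smul_neg, two_smul, ← sub_eq_zero]
      nth_rewrite 1 [← hb]
      abel
    refine ⟨-c, ?_, ?_⟩
    · simpa [IsSymm] using hbt
    · rw [← ha, neg_neg]
  · rintro ⟨S, -, rfl⟩
    simp only [Amat, Bmat, fromBlocks_transpose, fromBlocks_multiply, fromBlocks_inj]
    simp [two_smul]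
  · rintro S rfl hS
    have hmap : (fromBlocks ((2 : ℂ) • S) (-S) (-S) ((2 : ℂ) • S)).map Complex.im =
        fromBlocks ((2 : ℝ) • S.map Complex.im) (-S.map Complex.im) (-S.map Complex.im)
          ((2 : ℝ) • S.map Complex.im) := by
      rw [fromBlocks_map]
      congr 1 <;> ext i j <;> simp
    rw [hmap]
    exact hS.fromBlocks_two_smul_neg
end

section
/- In ℚ[X₀, X₁, X₂, X₃] one has the exact polynomial identity (X₀X₁X₂X₃)² − P(X₂X₃, X₁X₃, X₁X₂) = X₀²X₁²X₂²X₃² − X₁⁴X₂⁴ − X₁⁴X₃⁴ − X₂⁴X₃⁴ + X₁⁴X₂²X₃² + X₁²X₂⁴X₃² + X₁²X₂²X₃⁴, where P(Z₀, Z₁, Z₂) := Z₀⁴ + Z₁⁴ + Z₂⁴ − Z₀²Z₁² − Z₀²Z₂² − Z₁²Z₂²; moreover, over ℂ (with ω a primitive cube root of unity) P factors as P = (Z₀² + ω²Z₁² + ωZ₂²)(Z₀² + ωZ₁² + ω²Z₂²). Hence the map (X₀:X₁:X₂:X₃) ↦ (Z₀:Z₁:Z₂:T) = (X₂X₃ :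 X₁X₃ : X₁X₂ : X₀X₁X₂X₃) carries the octic surface S₆₇ into the double cover T² = P(Z₀,Z₁,Z₂) of P², whose branch conic is reducible. -/
open MvPolynomial

/-- `P(Z₀,Z₁,Z₂) = Z₀⁴ + Z₁⁴ + Z₂⁴ − Z₀²Z₁² − Z₀²Z₂² − Z₁²Z₂²`, over ℚ. -/
noncomputable def Ppoly : MvPolynomial (Fin 3) ℚ :=
  X 0^4 + X 1^4 + X 2^4 - X 0^2*X 1^2 - X 0^2*X 2^2 - X 1^2*X 2^2

/-- `P(Z₀,Z₁,Z₂)`, over ℂ. -/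
noncomputable def PpolyC : MvPolynomial (Fin 3) ℂ :=
  X 0^4 + X 1^4 + X 2^4 - X 0^2*X 1^2 - X 0^2*X 2^2 - X 1^2*X 2^2

/-- In `ℚ[X₀,X₁,X₂,X₃]` one has the exact identity
`(X₀X₁X₂X₃)² − P(X₂X₃, X₁X₃, X₁X₂) = X₀²X₁²X₂²X₃² − X₁⁴X₂⁴ − X₁⁴X₃⁴ − X₂⁴X₃⁴ +
X₁⁴X₂²X₃² + X₁²X₂⁴X₃² + X₁²X₂²X₃⁴`, and over ℂ (with `ω` a primitive cube root of
unity) `P` factors as `(Z₀² + ω²Z₁² + ωZ₂²)(Z₀² + ωZ₁² + ω²Z₂²)`. Hence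
`(X₀:X₁:X₂:X₃) ↦ (X₂X₃ : X₁X₃ : X₁X₂ : X₀X₁X₂X₃)` carries the octic surface `S₆₇`
into the double cover `T² = P(Z₀,Z₁,Z₂)` of `P²`, whose branch conic is reducible. -/
theorem stmt_18 (ω : ℂ) (hω : IsPrimitiveRoot ω 3) :
    ((X 0 * X 1 * X 2 * X 3 : MvPolynomial (Fin 4) ℚ) ^ 2
        - aeval ![X 2 * X 3, X 1 * X 3, X 1 * X 2] Ppoly
      = X 0^2*X 1^2*X 2^2*X 3^2 - X 1^4*X 2^4 - X 1^4*X 3^4 - X 2^4*X 3^4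
        + X 1^4*X 2^2*X 3^2 + X 1^2*X 2^4*X 3^2 + X 1^2*X 2^2*X 3^4) ∧
    PpolyC = (X 0^2 + C (ω^2) * X 1^2 + C ω * X 2^2)
        * (X 0^2 + C ω * X 1^2 + C (ω^2) * X 2^2) := by
  constructor
  · simp [Ppoly]
    ring
  · have h : (1 : MvPolynomial (Fin 3) ℂ) + C ω + C ω ^ 2 = 0 := by
      have hsum := hω.geom_sum_eq_zero (by norm_num)
      simpa [Finset.sum_range_succ] using congrArg (C (σ := Fin 3)) hsum
    simp only [PpolyC, C_pow]
    linear_combination (-(X 0 ^ 2 * X 1 ^ 2) - X 0 ^ 2 * X 2 ^ 2 - (C ω - 1) * (X 1 ^ 4 + X 2 ^ 4)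
      - (C ω ^ 2 - C ω + 1) * X 1 ^ 2 * X 2 ^ 2) * h
end
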